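/- Let f : 𝔸 → 𝔸 be a positive twist map, F : ℝ² → ℝ² a lift of f, and K ⊆ 𝔸 a compact set containing no point with over-conjugate points. Then there exists β ∈ (0, 1/2) such that for all z, z' ∈ π⁻¹(K) satisfying (i) the oriented angle ≺(v, z'−z) belongs to [0, β] + ℤ, and (ii) the straight segment joining z to z' is contained in π⁻¹(K), one has p₁(Fⁿ(z')) − p₁(Fⁿ(z)) > 0 for every n ≥ 1. -/

import Mathlib

noncomputable section

open MeasureTheory Set Filter Topology Function

/-- The annulus `𝔸 = (ℝ/ℤ) × ℝ`. -/
abbrev Ann : Type := AddCircle (1 : ℝ) × ℝ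

/-- The plane `ℝ²`, universal cover of the annulus. -/
abbrev Pl : Type := ℝ × ℝ

/-- The covering projection `π : ℝ² → 𝔸`, `π(x,y) = (x + ℤ, y)`. -/
def pr : Pl → Ann := fun p => ((p.1 : AddCircle (1 : ℝ)), p.2)

/-- The vertical vector `v = (0,1)`. -/
def vv : Pl := (0, 1)

/-- Data of a `C¹` diffeomorphism `f` of the annulus, isotopic to the identity,
presented through a lifted isotopy `(Ft t)_{t ∈ [0,1]}` of `C¹` diffeomorphisms of the
plane commuting with the deck transformation, with `Ft 0 = id` and `Ft 1` a lift of `f`,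
whose derivatives depend continuously on `(t, z)`. -/
structure IsotopySetup where
  f : Ann → Ann
  Ft : ℝ → Pl → Pl
  lift_f : ∀ p, pr (Ft 1 p) = f (pr p)
  Ft_zero : Ft 0 = id
  Ft_periodic : ∀ t, ∀ p : Pl, Ft t (p + (1, 0)) = Ft t p + (1, 0)
  Ft_smooth : ∀ t ∈ Icc (0:ℝ) 1, ContDiff ℝ 1 (Ft t)
  Ft_diffeo : ∀ t ∈ Icc (0:ℝ) 1, ∃ G : Pl → Pl, ContDiff ℝ 1 G ∧
      Function.LeftInverse G (Ft t) ∧ Function.RightInverse G (Ft t)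
  Ft_cont : ContinuousOn (fun q : ℝ × Pl => Ft q.1 q.2) (Icc (0:ℝ) 1 ×ˢ univ)
  DFt_cont : ContinuousOn (fun q : ℝ × Pl => fderiv ℝ (Ft q.1) q.2) (Icc (0:ℝ) 1 ×ˢ univ)

namespace IsotopySetup

variable (S : IsotopySetup)

/-- The canonical lift `F : ℝ² → ℝ²` of `f`. -/
def F : Pl → Pl := S.Ft 1

/-- The extended linearized isotopy: for `t ≥ 0`, `D t p` is the derivative at `p` of the
extended isotopy `f_t`, determined by `Df_{n+s} = Df_s ∘ Df^n` for `n ∈ ℕ`, `s ∈ [0,1)`. -/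
def D (t : ℝ) (p : Pl) : Pl →L[ℝ] Pl :=
  (fderiv ℝ (S.Ft (Int.fract t)) (S.F^[⌊t⌋₊] p)).comp (fderiv ℝ (S.F^[⌊t⌋₊]) p)

/-- `S.AngleVar p w n a` : the total angular variation on `[0,n]` of the vector `w ∈ T_{π(p)}𝔸`
under the extended linearized isotopy equals `a`; that is, `a = n·Torsionₙ(f, π(p), w)`.
Here `Θ` is a continuous lift of the angle `≺(v, Df_t(z)w)` (so that the direction of
`Df_t(z)w` is `(−sin(2πΘ(t)), cos(2πΘ(t)))`). -/
def AngleVar (p w : Pl) (n : ℕ) (a : ℝ) : Prop :=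
  ∃ Θ : ℝ → ℝ, ContinuousOn Θ (Icc 0 (n:ℝ)) ∧
    (∀ t ∈ Icc (0:ℝ) (n:ℝ), ∃ r : ℝ, 0 < r ∧
      S.D t p w = r • (-Real.sin (2 * Real.pi * Θ t), Real.cos (2 * Real.pi * Θ t))) ∧
    a = Θ n - Θ 0

/-- `S.TorsionFin p w n τ` : the finite-time torsion `Torsionₙ(f, π(p), w)` equals `τ`. -/
def TorsionFin (p w : Pl) (n : ℕ) (τ : ℝ) : Prop :=
  ∃ a : ℝ, S.AngleVar p w n a ∧ τ = a / n

/-- The asymptotic torsion at the lifted point `p` exists and equals `L`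
(for every choice of nonzero tangent vector `w`). -/
def TorsionLift (p : Pl) (L : ℝ) : Prop :=
  ∀ w : Pl, w ≠ 0 → ∃ a : ℕ → ℝ, (∀ n : ℕ, 1 ≤ n → S.AngleVar p w n (a n)) ∧
    Tendsto (fun n : ℕ => a n / (n : ℝ)) atTop (nhds L)

/-- The asymptotic torsion at `z ∈ 𝔸` exists and equals `L`. -/
def Torsion (z : Ann) (L : ℝ) : Prop :=
  ∃ p : Pl, pr p = z ∧ S.TorsionLift p L

open Classical in
/-- The asymptotic torsion as a function on the annulus (defaulting to `0` where undefined). -/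
def torsionFun (z : Ann) : ℝ :=
  if h : ∃ L, S.Torsion z L then h.choose else 0

/-- The lifted point `p` has conjugate points: `n·Torsionₙ(f,z,v) = −k/2` for some `n,k ≥ 1`. -/
def ConjLift (p : Pl) : Prop :=
  ∃ n k : ℕ, 1 ≤ n ∧ 1 ≤ k ∧ ∃ a : ℝ, S.AngleVar p vv n a ∧ a = -(k : ℝ) / 2

/-- The lifted point `p` has over-conjugate points: `n·Torsionₙ(f,z,v) < −1/2` for some `n ≥ 1`. -/
def OverConjLift (p : Pl) : Prop :=
  ∃ n : ℕ, 1 ≤ n ∧ ∃ a : ℝ, S.AngleVar p vv n a ∧ a < -(1:ℝ) / 2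

/-- The point `z ∈ 𝔸` has conjugate points. -/
def Conj (z : Ann) : Prop := ∃ p : Pl, pr p = z ∧ S.ConjLift p

/-- The point `z ∈ 𝔸` has over-conjugate points. -/
def OverConj (z : Ann) : Prop := ∃ p : Pl, pr p = z ∧ S.OverConjLift p

/-- `f` is a positive twist map: for every `x`, the map `y ↦ p₁(F(x,y))` is an increasing
diffeomorphism of `ℝ` onto `ℝ`. -/
def PosTwist : Prop :=
  ∀ x : ℝ, StrictMono (fun y => (S.F (x, y)).1) ∧
    Function.Surjective (fun y => (S.F (x, y)).1) ∧
    ∀ y : ℝ, 0 < deriv (fun y => (S.F (x, y)).1) y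

/-- `f` has no conjugate points (linearized-dynamics formulation): for every `z ∈ ℝ²` and
`n ≥ 1`, the first component of `DFⁿ(z)(0,1)` does not vanish. -/
def NoConjPts : Prop :=
  ∀ p : Pl, ∀ n : ℕ, 1 ≤ n → ((fderiv ℝ (S.F^[n]) p) (0, 1)).1 ≠ 0

/-- `f` is exact symplectic: it preserves the Lebesgue measure and `F*(y dx) − y dx = dS`
for a `C¹` function `S : ℝ² → ℝ` with `S(x+1,y) = S(x,y)`. -/
def ExactSymplectic : Prop :=
  MeasurePreserving S.f volume volume ∧
  ∃ Sg : Pl → ℝ, ContDiff ℝ 1 Sg ∧ (∀ p : Pl, Sg (p + (1, 0)) = Sg p) ∧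
    ∀ p : Pl,
      fderiv ℝ Sg p (1, 0) = (S.F p).2 * (fderiv ℝ S.F p (1, 0)).1 - p.2 ∧
      fderiv ℝ Sg p (0, 1) = (S.F p).2 * (fderiv ℝ S.F p (0, 1)).1

end IsotopySetup

/-- `γ` is an essential curve of the annulus: a topological embedding of the circle which is
not homotopic to a constant map. -/
def EssentialCurve (γ : C(AddCircle (1:ℝ), Ann)) : Prop :=
  Topology.IsEmbedding γ ∧ ∀ z : Ann, ¬ γ.Homotopic (ContinuousMap.const _ z)

/-- An open subset of the annulus is essential if it contains an essential curve. -/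
def EssentialSet (U : Set Ann) : Prop :=
  ∃ γ : C(AddCircle (1:ℝ), Ann), EssentialCurve γ ∧ range γ ⊆ U

/-- `f` restricted to `U` is `C⁰`-integrable: `U` is the disjoint union of a family of
`f`-invariant images of essential curves. -/
def C0IntegrableOn (f : Ann → Ann) (U : Set Ann) : Prop :=
  ∃ (ι : Type) (γ : ι → C(AddCircle (1:ℝ), Ann)),
    (∀ i, EssentialCurve (γ i) ∧ f '' range (γ i) = range (γ i)) ∧
    (⋃ i, range (γ i)) = U ∧
    Pairwise (Disjoint on fun i => range (γ i))

/-- `ℤ`-iterates of a bijection (negative iterates through the inverse map). -/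
def iterZ {α : Type*} [Nonempty α] (f : α → α) : ℤ → α → α
  | Int.ofNat n => f^[n]
  | Int.negSucc n => (Function.invFun f)^[n + 1]

/-- `ℐ(f)`: the union of all `f`-invariant essential curves. -/
def invCurveUnion (f : Ann → Ann) : Set Ann :=
  ⋃ γ ∈ {γ : C(AddCircle (1:ℝ), Ann) | EssentialCurve γ ∧ f '' range γ = range γ}, range γ


/-- unit vector of angle `θ`. -/
def ee (θ : ℝ) : Pl := (-Real.sin (2 * Real.pi * θ), Real.cos (2 * Real.pi * θ))

lemma ee_ne_zero (θ : ℝ) : ee θ ≠ 0 := by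
  intro h
  have h1 : -Real.sin (2 * Real.pi * θ) = 0 := congrArg Prod.fst h
  have h2 : Real.cos (2 * Real.pi * θ) = 0 := congrArg Prod.snd h
  have := Real.sin_sq_add_cos_sq (2 * Real.pi * θ)
  rw [h2, neg_eq_zero.1 h1] at this
  norm_num at this

lemma ee_half (θ : ℝ) : ee (θ - 1/2) = - ee θ := by
  have : 2 * Real.pi * (θ - 1/2) = 2 * Real.pi * θ - Real.pi := by ring
  simp only [ee, this, Real.sin_sub_pi, Real.cos_sub_pi]
  ext <;> simp

lemma ee_zero : ee 0 = (0, 1) := by simp [ee]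

lemma ee_continuous : Continuous ee := by
  unfold ee; fun_prop

lemma ee_pos {θ : ℝ} (h1 : -1/2 < θ) (h2 : θ < 0) : 0 < (ee θ).1 := by
  have hp := Real.pi_pos
  have : Real.sin (2 * Real.pi * θ) < 0 :=
    Real.sin_neg_of_neg_of_neg_pi_lt (by nlinarith) (by nlinarith)
  simpa [ee] using this

lemma ee_nonpos {θ : ℝ} (h1 : 0 ≤ θ) (h2 : θ ≤ 1/2) : (ee θ).1 ≤ 0 := by
  have hp := Real.pi_pos
  have : 0 ≤ Real.sin (2 * Real.pi * θ) :=
    Real.sin_nonneg_of_nonneg_of_le_pi (by positivity) (by nlinarith)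
  simpa [ee] using this

lemma ee_nonpos' {θ : ℝ} (h1 : -1 ≤ θ) (h2 : θ ≤ -1/2) : (ee θ).1 ≤ 0 := by
  have hp := Real.pi_pos
  have h := Real.sin_nonneg_of_nonneg_of_le_pi (x := 2 * Real.pi * θ + 2 * Real.pi)
    (by nlinarith) (by nlinarith)
  rw [Real.sin_add_two_pi] at h
  simpa [ee] using h

lemma avoid_lt {φ : ℝ → ℝ} {c : ℝ} (hφ : ContinuousOn φ (Icc 0 1))
    (h : ∀ t ∈ Icc (0:ℝ) 1, φ t ≠ c) (h0 : φ 0 < c) : φ 1 < c := by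
  by_contra hc
  push Not at hc
  obtain ⟨t, ht, hh⟩ := intermediate_value_Icc zero_le_one hφ ⟨h0.le, hc⟩
  exact h t ht hh

lemma avoid_gt {φ : ℝ → ℝ} {c : ℝ} (hφ : ContinuousOn φ (Icc 0 1))
    (h : ∀ t ∈ Icc (0:ℝ) 1, φ t ≠ c) (h0 : c < φ 0) : c < φ 1 := by
  by_contra hc
  push Not at hc
  obtain ⟨t, ht, hh⟩ := intermediate_value_Icc' zero_le_one hφ ⟨hc, h0.le⟩
  exact h t ht hh

lemma angle_lift {A : Type} [TopologicalSpace A] [SimplyConnectedSpace A]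
    [LocallyPathConnectedSpace A] (Q : A → Pl) (hQ : Continuous Q) (h0 : ∀ a, Q a ≠ 0)
    (a₀ : A) (θ₀ r₀ : ℝ) (hr : 0 < r₀) (hθ : Q a₀ = r₀ • ee θ₀) :
    ∃ Θ : A → ℝ, Continuous Θ ∧ Θ a₀ = θ₀ ∧ ∀ a, ∃ r : ℝ, 0 < r ∧ Q a = r • ee (Θ a) := by
  have hpi := Real.pi_pos
  let f : C(A, ℂ) := ⟨fun a => ((Q a).2 : ℂ) - ((Q a).1 : ℂ) * Complex.I, by fun_prop⟩
  have hre : ∀ a, (f a).re = (Q a).2 := fun a => by simp [f]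
  have him : ∀ a, (f a).im = -(Q a).1 := fun a => by simp [f]
  have hs : ∀ a, f a ∈ ({0}ᶜ : Set ℂ) := by
    intro a h
    have h' : f a = 0 := h
    apply h0 a
    have h1 := hre a
    have h2 := him a
    rw [h'] at h1 h2
    ext
    · simpa using h2.symm
    · simpa using h1.symm
  have he : Complex.exp (⟨Real.log r₀, 2 * Real.pi * θ₀⟩ : ℂ) = f a₀ := by
    apply Complex.ext
    · rw [Complex.exp_re, hre, hθ]; simp [Real.exp_log hr, ee]
    · rw [Complex.exp_im, him, hθ]; simp [Real.exp_log hr, ee]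
  obtain ⟨W, ⟨hW0, hW⟩, -⟩ := Complex.isCoveringMapOn_exp.existsUnique_continuousMap_lifts f he hs
  refine ⟨fun a => (W a).im / (2 * Real.pi), by fun_prop, ?_, fun a => ⟨Real.exp (W a).re, Real.exp_pos _, ?_⟩⟩
  · simp only [hW0]; field_simp
  · have h : Complex.exp (W a) = f a := congrFun hW a
    have e1 : 2 * Real.pi * ((W a).im / (2 * Real.pi)) = (W a).im := by field_simp
    have h1 := hre a
    have h2 := him a
    rw [← h, Complex.exp_re] at h1
    rw [← h, Complex.exp_im] at h2
    ext
    · simp only [ee, e1, Prod.smul_fst, smul_eq_mul]; linarith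
    · simp only [ee, e1, Prod.smul_snd, smul_eq_mul]; linarith

lemma sin_diff_of_parallel {a b k : ℝ} (h : ee a = k • ee b) :
    Real.sin (2 * Real.pi * (a - b)) = 0 := by
  have h1 : -Real.sin (2 * Real.pi * a) = k * -Real.sin (2 * Real.pi * b) := congrArg Prod.fst h
  have h2 : Real.cos (2 * Real.pi * a) = k * Real.cos (2 * Real.pi * b) := congrArg Prod.snd h
  rw [mul_sub, Real.sin_sub, h2]
  have : Real.sin (2 * Real.pi * a) = k * Real.sin (2 * Real.pi * b) := by linarith
  rw [this]; ring

/-- clamp to `[0,1]`. -/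
def cl (t : ℝ) : ℝ := max 0 (min t 1)

lemma cl_cont : Continuous cl := by unfold cl; fun_prop
lemma cl_mem (t : ℝ) : cl t ∈ Icc (0:ℝ) 1 := by
  unfold cl; exact ⟨le_max_left _ _, max_le zero_le_one (min_le_right _ _)⟩
lemma cl_eq {t : ℝ} (h : t ∈ Icc (0:ℝ) 1) : cl t = t := by
  unfold cl; rw [min_eq_left h.2, max_eq_right h.1]

namespace IsotopySetup
variable (S : IsotopySetup)

lemma diff_Ft {t : ℝ} (ht : t ∈ Icc (0:ℝ) 1) : Differentiable ℝ (S.Ft t) :=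
  (S.Ft_smooth t ht).differentiable one_ne_zero

lemma inj_Ft {t : ℝ} (ht : t ∈ Icc (0:ℝ) 1) : Function.Injective (S.Ft t) := by
  obtain ⟨G, -, h, -⟩ := S.Ft_diffeo t ht
  exact h.injective

lemma fderiv_inj {t : ℝ} (ht : t ∈ Icc (0:ℝ) 1) (q w : Pl)
    (h : fderiv ℝ (S.Ft t) q w = 0) : w = 0 := by
  obtain ⟨G, hG, hl, -⟩ := S.Ft_diffeo t ht
  have h1 : HasFDerivAt (G ∘ S.Ft t)
      ((fderiv ℝ G (S.Ft t q)).comp (fderiv ℝ (S.Ft t) q)) q :=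
    ((hG.differentiable one_ne_zero) _).hasFDerivAt.comp q (S.diff_Ft ht q).hasFDerivAt
  have h2 : G ∘ S.Ft t = id := funext hl
  rw [h2] at h1
  have h3 := h1.unique (hasFDerivAt_id q)
  have h4 := congrArg (fun L : Pl →L[ℝ] Pl => L w) h3
  simp only [ContinuousLinearMap.comp_apply, h, map_zero] at h4
  simpa using h4.symm

lemma DFt_clcont : Continuous (fun q : ℝ × Pl => fderiv ℝ (S.Ft (cl q.1)) q.2) := by
  have h : Continuous (fun q : ℝ × Pl => (cl q.1, q.2)) := by
    have := cl_cont; fun_prop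
  exact S.DFt_cont.comp_continuous h (fun q => ⟨cl_mem _, mem_univ _⟩)

/-- One step of the lifted angular dynamics. -/
def Step (q : Pl) (a b : ℝ) : Prop :=
  ∃ φ : ℝ → ℝ, ContinuousOn φ (Icc 0 1) ∧ φ 0 = a ∧ φ 1 = b ∧
    ∀ t ∈ Icc (0:ℝ) 1, ∃ r : ℝ, 0 < r ∧ fderiv ℝ (S.Ft t) q (ee a) = r • ee (φ t)

lemma step_exists (q : Pl) (a : ℝ) : ∃ b, S.Step q a b := by
  obtain ⟨Θ, hc, h0, h⟩ := angle_lift (A := ℝ) (fun t => fderiv ℝ (S.Ft (cl t)) q (ee a))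
    (by
      have h := S.DFt_clcont.comp (f := fun t : ℝ => (t, q)) (by fun_prop)
      exact h.clm_apply continuous_const)
    (fun t h => ee_ne_zero a (S.fderiv_inj (cl_mem t) _ _ h)) 0 a 1 one_pos
    (by rw [cl_eq (by simp), S.Ft_zero]; simp)
  refine ⟨Θ 1, Θ, hc.continuousOn, h0, rfl, fun t ht => ?_⟩
  have := h t
  rwa [cl_eq ht] at this

lemma step_half {q : Pl} {a b : ℝ} (h : S.Step q a b) : S.Step q (a - 1/2) (b - 1/2) := by
  obtain ⟨φ, hc, h0, h1, h⟩ := h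
  refine ⟨fun t => φ t - 1/2, hc.sub continuousOn_const, by simp [h0], by simp [h1], fun t ht => ?_⟩
  obtain ⟨r, hr, e⟩ := h t ht
  refine ⟨r, hr, ?_⟩
  simp only [ee_half, map_neg, e, smul_neg]

lemma step_compare {q : Pl} {a b a' b' : ℝ} (h : S.Step q a b) (h' : S.Step q a' b')
    (h1 : a < a') (h2 : a' < a + 1/2) : b < b' ∧ b' < b + 1/2 := by
  have hpi := Real.pi_pos
  obtain ⟨φ, hc, h0, hb, h⟩ := h
  obtain ⟨φ', hc', h0', hb', h'⟩ := h'
  have key : ∀ t ∈ Icc (0:ℝ) 1, ∀ k : ℝ, ee (φ' t) ≠ k • ee (φ t) := by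
    intro t ht k hk
    obtain ⟨r, hr, e⟩ := h t ht
    obtain ⟨r', hr', e'⟩ := h' t ht
    have : ee a' - (r' * k / r) • ee a = 0 := by
      apply S.fderiv_inj ht q
      rw [map_sub, map_smul, e, e', hk, smul_smul, smul_smul, div_mul_cancel₀ _ hr.ne', sub_self]
    have h3 := sin_diff_of_parallel (sub_eq_zero.1 this)
    have : 0 < Real.sin (2 * Real.pi * (a' - a)) :=
      Real.sin_pos_of_pos_of_lt_pi (by have : 0 < a' - a := by linarith
                                       positivity) (by nlinarith)
    linarith
  have hd : ContinuousOn (fun t => φ' t - φ t) (Icc 0 1) := hc'.sub hc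
  have k1 := avoid_gt (c := 0) hd (fun t ht hh => key t ht 1 (by
    rw [one_smul]; congr 1; linarith)) (by simp only [h0, h0']; linarith)
  have k2 := avoid_lt (c := 1/2) hd (fun t ht hh => key t ht (-1) (by
    have : φ t = φ' t - 1/2 := by linarith
    rw [this, ee_half]; simp)) (by simp only [h0, h0']; linarith)
  simp only [hb, hb'] at k1 k2
  constructor <;> linarith

lemma one_mem : (1:ℝ) ∈ Icc (0:ℝ) 1 := by simp

lemma step_end {q : Pl} {a b : ℝ} (h : S.Step q a b) :
    ∃ r : ℝ, 0 < r ∧ fderiv ℝ S.F q (ee a) = r • ee b := by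
  obtain ⟨φ, hc, h0, hb, h⟩ := h
  rw [← hb]; exact h 1 one_mem

lemma F_smooth : ContDiff ℝ 1 S.F := S.Ft_smooth 1 one_mem

lemma F_diff : Differentiable ℝ S.F := S.F_smooth.differentiable one_ne_zero

lemma Fn_diff (n : ℕ) : Differentiable ℝ (S.F^[n]) := S.F_diff.iterate n

lemma fderiv_succ (n : ℕ) (p w : Pl) :
    fderiv ℝ (S.F^[n+1]) p w = fderiv ℝ S.F (S.F^[n] p) (fderiv ℝ (S.F^[n]) p w) := by
  rw [Function.iterate_succ', fderiv_comp _ (S.F_diff _) (S.Fn_diff n _)]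
  rfl

lemma twist_deriv (ht : S.PosTwist) (p : Pl) : 0 < (fderiv ℝ S.F p (0, 1)).1 := by
  have h := (ht p.1).2.2 p.2
  have h1 : HasDerivAt (fun y : ℝ => ((p.1, y) : Pl)) (0, 1) p.2 :=
    (hasDerivAt_const _ _).prodMk (hasDerivAt_id _)
  have h2 : HasDerivAt (fun y : ℝ => S.F (p.1, y)) (fderiv ℝ S.F p (0, 1)) p.2 :=
    (S.F_diff p).hasFDerivAt.comp_hasDerivAt p.2 h1
  have h3 := (ContinuousLinearMap.fst ℝ ℝ ℝ).hasFDerivAt.comp_hasDerivAt p.2 h2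
  have h4 : deriv (fun y => (S.F (p.1, y)).1) p.2 = (fderiv ℝ S.F p (0, 1)).1 := h3.deriv
  rwa [h4] at h

lemma line_inj (ht : S.PosTwist) {p q : Pl} (h1 : q.1 = p.1) (h2 : (S.F q).1 = (S.F p).1) :
    q = p := by
  have h := (ht p.1).1.injective
  have : q.2 = p.2 := h (by
    show (S.F (p.1, q.2)).1 = (S.F (p.1, p.2)).1
    have e : (p.1, q.2) = q := by rw [← h1]
    rw [e]; exact h2)
  exact Prod.ext h1 this

lemma avoid_ray (ht : S.PosTwist) (p : Pl) :
    (∀ q : Pl, p.1 < q.1 → ¬((S.F q).1 = (S.F p).1 ∧ (S.F p).2 < (S.F q).2)) ∨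
    (∀ q : Pl, p.1 < q.1 → ¬((S.F q).1 = (S.F p).1 ∧ (S.F q).2 < (S.F p).2)) := by
  by_contra hcon
  push Not at hcon
  obtain ⟨⟨q1, hq1, hX1, hY1⟩, ⟨q2, hq2, hX2, hY2⟩⟩ := hcon
  obtain ⟨G, hG, hl, hr⟩ := S.Ft_diffeo 1 one_mem
  have hl' : ∀ q, G (S.F q) = q := hl
  have hr' : ∀ q, S.F (G q) = q := hr
  have hFc := S.F_smooth.continuous
  have hGc := hG.continuous
  -- no crossing of the vertical line
  have hno : ∀ y, (G ((S.F p).1, y)).1 = p.1 → y = (S.F p).2 := by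
    intro y hy
    have h1 : G ((S.F p).1, y) = p := S.line_inj ht hy (by rw [hr'])
    have := hr' ((S.F p).1, y)
    rw [h1] at this
    rw [this]
  have hgc : Continuous (fun y : ℝ => (G ((S.F p).1, y)).1) := by fun_prop
  have hval : ∀ q : Pl, (S.F q).1 = (S.F p).1 → (G ((S.F p).1, (S.F q).2)).1 = q.1 := by
    intro q hq
    rw [← hq, Prod.mk.eta, hl']
  have claim : ∀ q : Pl, (S.F q).1 = (S.F p).1 → q ≠ p → p.1 < q.1 := by
    intro q hq hqp
    by_contra hlt
    push Not at hlt
    have hne : (S.F q).2 ≠ (S.F p).2 := by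
      intro h
      apply hqp
      have : S.F q = S.F p := Prod.ext hq h
      rw [← hl' q, this, hl']
    have aux : ∀ q' : Pl, (S.F q').1 = (S.F p).1 → p.1 < q'.1 →
        ∃ y ∈ uIcc (S.F q).2 (S.F q').2, y = (S.F p).2 := by
      intro q' hX hlt'
      have hm : p.1 ∈ uIcc ((G ((S.F p).1, (S.F q).2)).1) ((G ((S.F p).1, (S.F q').2)).1) := by
        rw [hval q hq, hval q' hX]
        exact mem_uIcc.2 (Or.inl ⟨hlt, hlt'.le⟩)
      obtain ⟨y, hy, e⟩ := intermediate_value_uIcc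
        (f := fun y : ℝ => (G ((S.F p).1, y)).1) hgc.continuousOn hm
      exact ⟨y, hy, hno y e⟩
    rcases lt_or_gt_of_ne hne with h | h
    · obtain ⟨y, hy, e⟩ := aux q2 hX2 hq2
      rw [mem_uIcc] at hy
      rcases hy with hy | hy <;> linarith [hy.1, hy.2]
    · obtain ⟨y, hy, e⟩ := aux q1 hX1 hq1
      rw [mem_uIcc] at hy
      rcases hy with hy | hy <;> linarith [hy.1, hy.2]
  have hper : S.F (p - (1, 0)) = S.F p - (1, 0) := by
    have h : S.F (p - (1, 0) + (1, 0)) = S.F (p - (1, 0)) + (1, 0) := S.Ft_periodic 1 (p - (1, 0))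
    rw [sub_add_cancel] at h
    rw [h, add_sub_cancel_right]
  have left : ∀ q : Pl, q.1 < p.1 → (S.F q).1 < (S.F p).1 := by
    intro q hq
    by_contra hge
    push Not at hge
    have hne : ∀ q' : Pl, q'.1 < p.1 → (S.F q').1 ≠ (S.F p).1 := by
      intro q' hq' h
      have := claim q' h (by rintro rfl; exact lt_irrefl _ hq')
      linarith
    have h0 : (S.F p).1 < (S.F q).1 := lt_of_le_of_ne hge (hne q hq).symm
    have hc : Continuous (fun t : ℝ => (S.F (q + t • ((p - (1, 0)) - q))).1) := by fun_prop
    have := avoid_gt (c := (S.F p).1) hc.continuousOn (fun t htt => hne _ (by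
      simp only [Prod.fst_add, Prod.smul_fst, Prod.fst_sub, smul_eq_mul]
      rcases htt with ⟨ha, hb⟩
      rcases eq_or_lt_of_le ha with h | h
      · rw [← h]; simpa using hq
      · nlinarith)) (by simpa using h0)
    simp only [one_smul, add_sub_cancel, hper, Prod.fst_sub] at this
    linarith
  have hlim : (S.F (p.1, p.2 + 1)).1 ≤ (S.F p).1 := by
    have hc : Continuous (fun x : ℝ => (S.F (x, p.2 + 1)).1) := by fun_prop
    have hT : Tendsto (fun x : ℝ => (S.F (x, p.2 + 1)).1) (𝓝[<] p.1)
        (𝓝 (S.F (p.1, p.2 + 1)).1) := hc.continuousAt.tendsto.mono_left nhdsWithin_le_nhds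
    refine le_of_tendsto hT ?_
    filter_upwards [self_mem_nhdsWithin] with x hx
    exact (left (x, p.2 + 1) hx).le
  have : (S.F (p.1, p.2)).1 < (S.F (p.1, p.2 + 1)).1 := (ht p.1).1 (by linarith)
  rw [Prod.mk.eta] at this
  linarith

/-- The chord homotopy. -/
def Q (p : Pl) (x : ℝ × ℝ) : Pl :=
  ∫ σ in (0:ℝ)..1, fderiv ℝ (S.Ft (cl x.2)) (p + (σ * cl x.1) • ((cl x.1, 1 - cl x.1) : Pl))
    (cl x.1, 1 - cl x.1)

lemma Q_cont (p : Pl) : Continuous (S.Q p) := by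
  have hcl := cl_cont
  unfold Q
  apply intervalIntegral.continuous_parametric_intervalIntegral_of_continuous'
  have h := S.DFt_clcont.comp (f := fun y : (ℝ × ℝ) × ℝ =>
    (y.1.2, p + (y.2 * cl y.1.1) • ((cl y.1.1, 1 - cl y.1.1) : Pl))) (by fun_prop)
  exact h.clm_apply (g := fun y : (ℝ × ℝ) × ℝ => ((cl y.1.1, 1 - cl y.1.1) : Pl)) (by fun_prop)

lemma Q_smul (p : Pl) {s t : ℝ} (hs : s ∈ Icc (0:ℝ) 1) (ht : t ∈ Icc (0:ℝ) 1) :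
    s • S.Q p (s, t) = S.Ft t (p + s • ((s, 1 - s) : Pl)) - S.Ft t p := by
  unfold Q
  simp only [cl_eq hs, cl_eq ht]
  rw [← intervalIntegral.integral_smul]
  have hd : ∀ σ ∈ uIcc (0:ℝ) 1, HasDerivAt (fun σ : ℝ => S.Ft t (p + (σ * s) • ((s, 1 - s) : Pl)))
      (s • fderiv ℝ (S.Ft t) (p + (σ * s) • ((s, 1 - s) : Pl)) (s, 1 - s)) σ := by
    intro σ _
    have h1 : HasDerivAt (fun σ : ℝ => p + (σ * s) • ((s, 1 - s) : Pl)) (s • ((s, 1 - s) : Pl)) σ := by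
      have h0 : HasDerivAt (fun σ : ℝ => σ * s) s σ := by
        simpa using (hasDerivAt_id σ).mul_const s
      exact (h0.smul_const _).const_add p
    have h2 := (S.diff_Ft ht (p + (σ * s) • ((s, 1 - s) : Pl))).hasFDerivAt.comp_hasDerivAt σ h1
    rw [map_smul] at h2
    exact h2
  rw [intervalIntegral.integral_eq_sub_of_hasDerivAt hd]
  · simp
  · apply Continuous.intervalIntegrable
    have h := ((S.Ft_smooth t ht).continuous_fderiv one_ne_zero).comp
      (f := fun σ : ℝ => p + (σ * s) • ((s, 1 - s) : Pl)) (by fun_prop)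
    exact (h.clm_apply continuous_const).const_smul s

lemma Q_zero (p : Pl) {t : ℝ} (ht : t ∈ Icc (0:ℝ) 1) :
    S.Q p (0, t) = fderiv ℝ (S.Ft t) p (0, 1) := by
  unfold Q
  have : cl 0 = 0 := cl_eq (by simp)
  simp [this, cl_eq ht]

lemma Q_cl (p : Pl) (x : ℝ × ℝ) : S.Q p x = S.Q p (cl x.1, cl x.2) := by
  simp only [Q, cl_eq (cl_mem _)]

lemma Q_ne (p : Pl) (x : ℝ × ℝ) : S.Q p x ≠ 0 := by
  rw [Q_cl]
  have hs := cl_mem x.1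
  have ht := cl_mem x.2
  set s := cl x.1
  set t := cl x.2
  intro h
  rcases eq_or_ne s 0 with h0 | h0
  · rw [h0, S.Q_zero p ht] at h
    have := congrArg Prod.snd (S.fderiv_inj ht _ _ h)
    simp at this
  · have h1 := S.Q_smul p hs ht
    rw [h, smul_zero] at h1
    have h2 := S.inj_Ft ht (sub_eq_zero.1 h1.symm)
    have h3 := congrArg Prod.fst (add_eq_left.1 h2)
    simp at h3
    exact h0 h3

lemma step_twist (ht : S.PosTwist) (p : Pl) : ∃ b, S.Step p 0 b ∧ -1/2 < b ∧ b < 0 := by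
  have m0 : (0:ℝ) ∈ Icc (0:ℝ) 1 := by simp
  have m1 : (1:ℝ) ∈ Icc (0:ℝ) 1 := by simp
  have e14 : ee (1/4) = (-1, 0) := by
    have : 2 * Real.pi * (1/4) = Real.pi / 2 := by ring
    simp only [ee, this, Real.sin_pi_div_two, Real.cos_pi_div_two]
  have em12 : ee (-1/2) = (0, -1) := by
    have := ee_half 0
    rw [ee_zero] at this
    rw [show (-1/2 : ℝ) = 0 - 1/2 by norm_num, this]; simp
  have e12 : ee (1/2) = (0, -1) := by
    have := ee_half (1/2)
    rw [sub_self, ee_zero] at this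
    rw [← neg_neg (ee (1/2)), ← this]; simp
  have em1 : ee (-1) = (0, 1) := by
    have := ee_half (-1/2)
    rw [em12] at this
    rw [show (-1 : ℝ) = -1/2 - 1/2 by norm_num, this]; simp
  obtain ⟨Θ, hc, h0, h⟩ := angle_lift (A := ℝ × ℝ) (S.Q p) (S.Q_cont p) (S.Q_ne p) (0, 0) 0 1 one_pos
    (by rw [S.Q_zero p m0, S.Ft_zero, ee_zero]; simp)
  -- bottom side
  have hbot : ∀ s ∈ Icc (0:ℝ) 1, S.Q p (s, 0) = (s, 1 - s) := by
    intro s hs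
    rcases eq_or_ne s 0 with h0 | h0
    · rw [h0, S.Q_zero p m0, S.Ft_zero]; simp
    · have h1 := S.Q_smul p hs m0
      rw [S.Ft_zero] at h1
      simp only [id, add_sub_cancel_left] at h1
      exact smul_right_injective _ h0 h1
  have hright : ∀ t ∈ Icc (0:ℝ) 1, S.Q p (1, t) = (1, 0) := by
    intro t ht
    have h1 := S.Q_smul p m1 ht
    rw [one_smul, one_smul, sub_self, S.Ft_periodic] at h1
    simpa using h1
  have cb : ContinuousOn (fun s : ℝ => Θ (s, 0)) (Icc 0 1) := by
    apply Continuous.continuousOn; fun_prop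
  have cr : ContinuousOn (fun t : ℝ => Θ (1, t)) (Icc 0 1) := by
    apply Continuous.continuousOn; fun_prop
  have ctop : Continuous (fun s : ℝ => Θ (1 - s, 1)) := by fun_prop
  have cl0 : ContinuousOn (fun t : ℝ => Θ (0, t)) (Icc 0 1) := by
    apply Continuous.continuousOn; fun_prop
  -- corner (1,0)
  have c1 : Θ (1, 0) < 1/4 := by
    refine avoid_lt cb (fun s hs hh => ?_) (by simp only [h0]; norm_num)
    obtain ⟨r, hr, e⟩ := h (s, 0)
    rw [hbot s hs, hh, e14] at e
    have := congrArg Prod.fst e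
    have h2 := congrArg Prod.snd e
    simp at this h2
    linarith [hs.1, hs.2]
  have c2 : -1/2 < Θ (1, 0) := by
    refine avoid_gt cb (fun s hs hh => ?_) (by simp only [h0]; norm_num)
    obtain ⟨r, hr, e⟩ := h (s, 0)
    rw [hbot s hs, hh, em12] at e
    have := congrArg Prod.fst e
    have h2 := congrArg Prod.snd e
    simp at this h2
    linarith [hs.1, hs.2]
  have rpos : ∀ t ∈ Icc (0:ℝ) 1, 0 < (ee (Θ (1, t))).1 := by
    intro t ht
    obtain ⟨r, hr, e⟩ := h (1, t)
    rw [hright t ht] at e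
    have := congrArg Prod.fst e
    simp only [Prod.smul_fst, smul_eq_mul] at this
    by_contra hn
    nlinarith
  have c3 : Θ (1, 0) < 0 := by
    by_contra hn
    push Not at hn
    linarith [rpos 0 m0, ee_nonpos hn (by linarith)]
  have c4 : Θ (1, 1) < 0 := by
    refine avoid_lt cr (fun t ht hh => ?_) c3
    have := rpos t ht
    rw [hh, ee_zero] at this
    simp at this
  have c5 : -1/2 < Θ (1, 1) := by
    refine avoid_gt cr (fun t ht hh => ?_) c2
    have := rpos t ht
    rw [hh, em12] at this
    simp at this
  -- final corner
  have fpos : 0 < (ee (Θ (0, 1))).1 := by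
    obtain ⟨r, hr, e⟩ := h (0, 1)
    have h1 := S.twist_deriv ht p
    rw [S.Q_zero p m1] at e
    change fderiv ℝ S.F p (0, 1) = _ at e
    rw [e] at h1
    simp only [Prod.smul_fst, smul_eq_mul] at h1
    exact (mul_pos_iff_of_pos_left hr).1 h1
  have top : ∀ s : ℝ, s ∈ Icc (0:ℝ) 1 → (ee (Θ (s, 1))).1 = 0 → ∃ q : Pl, ∃ r : ℝ, p.1 < q.1 ∧
      0 < r ∧ S.F q - S.F p = r • ee (Θ (s, 1)) := by
    intro s hs hz
    have hs0 : s ≠ 0 := by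
      rintro rfl
      rw [hz] at fpos; exact lt_irrefl _ fpos
    have hsp : 0 < s := lt_of_le_of_ne hs.1 hs0.symm
    obtain ⟨r, hr, e⟩ := h (s, 1)
    refine ⟨p + s • ((s, 1 - s) : Pl), s * r, ?_, by positivity, ?_⟩
    · simp; positivity
    · have := S.Q_smul p hs m1
      rw [e, smul_smul] at this
      exact this.symm
  have A : (∀ s ∈ Icc (0:ℝ) 1, ee (Θ (s, 1)) ≠ (0, 1)) ∨ (∀ s ∈ Icc (0:ℝ) 1, ee (Θ (s, 1)) ≠ (0, -1)) := by
    rcases S.avoid_ray ht p with hA | hA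
    · left
      intro s hs hh
      obtain ⟨q, r, hq, hr, e⟩ := top s hs (by rw [hh])
      rw [hh] at e
      have e1 := congrArg Prod.fst e
      have e2 := congrArg Prod.snd e
      simp at e1 e2
      exact hA q hq ⟨by linarith, by linarith⟩
    · right
      intro s hs hh
      obtain ⟨q, r, hq, hr, e⟩ := top s hs (by rw [hh])
      rw [hh] at e
      have e1 := congrArg Prod.fst e
      have e2 := congrArg Prod.snd e
      simp at e1 e2
      exact hA q hq ⟨by linarith, by linarith⟩
  have mm : ∀ s ∈ Icc (0:ℝ) 1, 1 - s ∈ Icc (0:ℝ) 1 := fun s hs => ⟨by linarith [hs.2], by linarith [hs.1]⟩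
  have hfin : -1/2 < Θ (0, 1) ∧ Θ (0, 1) < 0 := by
    rcases A with hA | hA
    · have u : Θ (1 - 1, 1) < 0 := avoid_lt ctop.continuousOn (fun s hs hh => hA (1 - s) (mm s hs) (by
        rw [hh, ee_zero])) (by simpa using c4)
      have l : -1 < Θ (1 - 1, 1) := avoid_gt ctop.continuousOn (fun s hs hh => hA (1 - s) (mm s hs) (by
        rw [hh, em1])) (by simp only [sub_zero]; linarith)
      rw [sub_self] at u l
      refine ⟨?_, u⟩
      by_contra hn
      push Not at hn
      linarith [ee_nonpos' l.le hn]
    · have u : Θ (1 - 1, 1) < 1/2 := avoid_lt ctop.continuousOn (fun s hs hh => hA (1 - s) (mm s hs) (by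
        rw [hh, e12])) (by simp only [sub_zero]; linarith)
      have l : -1/2 < Θ (1 - 1, 1) := avoid_gt ctop.continuousOn (fun s hs hh => hA (1 - s) (mm s hs) (by
        rw [hh, em12])) (by simp only [sub_zero]; linarith)
      rw [sub_self] at u l
      refine ⟨l, ?_⟩
      by_contra hn
      push Not at hn
      linarith [ee_nonpos hn u.le]
  refine ⟨Θ (0, 1), ⟨fun t => Θ (0, t), cl0, h0, rfl, fun t ht => ?_⟩, hfin⟩
  have := h (0, t)
  rwa [S.Q_zero p ht, ← ee_zero] at this

lemma D_nat_add (n : ℕ) {τ : ℝ} (hτ : τ ∈ Icc (0:ℝ) 1) (p w : Pl) :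
    S.D (n + τ) p w = fderiv ℝ (S.Ft τ) (S.F^[n] p) (fderiv ℝ (S.F^[n]) p w) := by
  rcases eq_or_lt_of_le hτ.2 with h | h
  · subst h
    have h1 : ⌊(n:ℝ) + 1⌋₊ = n + 1 := by
      rw [Nat.floor_add_one (by positivity), Nat.floor_natCast]
    have h2 : Int.fract ((n:ℝ) + 1) = 0 := by simp
    simp only [D, h1, h2, S.Ft_zero, ContinuousLinearMap.comp_apply, fderiv_id,
      ContinuousLinearMap.id_apply]
    exact S.fderiv_succ n p w
  · have h1 : ⌊(n:ℝ) + τ⌋₊ = n := by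
      rw [Nat.floor_eq_iff (by linarith [hτ.1, n.cast_nonneg (α := ℝ)])]
      constructor <;> linarith [hτ.1]
    have h2 : Int.fract ((n:ℝ) + τ) = τ := by
      rw [Int.fract_natCast_add, Int.fract_eq_self.2 ⟨hτ.1, h⟩]
    simp only [D, h1, h2, ContinuousLinearMap.comp_apply]

lemma D_nat (n : ℕ) (p w : Pl) : S.D n p w = fderiv ℝ (S.F^[n]) p w := by
  have := S.D_nat_add n (τ := 0) (by simp) p w
  rw [add_zero, S.Ft_zero] at this
  simpa using this

/-- `Θ` represents the angle of the vertical vector on `[0,n]`. -/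
def Rep (p : Pl) (n : ℕ) (Θ : ℝ → ℝ) : Prop :=
  ContinuousOn Θ (Icc 0 (n:ℝ)) ∧
    ∀ t ∈ Icc (0:ℝ) (n:ℝ), ∃ r : ℝ, 0 < r ∧ S.D t p vv = r • ee (Θ t)

lemma rep_extend {p : Pl} {n : ℕ} {Θ : ℝ → ℝ} {b : ℝ} (h : S.Rep p n Θ)
    (hs : S.Step (S.F^[n] p) (Θ n) b) :
    ∃ Θ' : ℝ → ℝ, S.Rep p (n + 1) Θ' ∧ Θ' 0 = Θ 0 ∧ Θ' ((n + 1 : ℕ) : ℝ) = b := by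
  obtain ⟨hc, hr⟩ := h
  obtain ⟨φ, hφ, h0, h1, hφr⟩ := hs
  have hn : (0:ℝ) ≤ n := n.cast_nonneg
  let Θ' : ℝ → ℝ := fun t => if t ≤ n then Θ t else φ (t - n)
  have hl : ∀ t ∈ Icc (0:ℝ) n, Θ' t = Θ t := fun t ht => if_pos ht.2
  have hri : ∀ t ∈ Icc (n:ℝ) (n+1), Θ' t = φ (t - n) := by
    intro t ht
    rcases eq_or_lt_of_le ht.1 with h | h
    · rw [← h]; simp [Θ', h0]
    · exact if_neg (not_le.2 h)
  have hu : Icc (0:ℝ) ((n+1 : ℕ) : ℝ) = Icc (0:ℝ) n ∪ Icc (n:ℝ) (n+1) := by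
    push_cast
    rw [Icc_union_Icc_eq_Icc hn (by linarith)]
  refine ⟨Θ', ⟨?_, ?_⟩, hl 0 ⟨le_rfl, hn⟩, ?_⟩
  · rw [hu]
    apply ContinuousOn.union_of_isClosed _ _ isClosed_Icc isClosed_Icc
    · exact hc.congr hl
    · refine ContinuousOn.congr (f := fun t => φ (t - n)) ?_ hri
      exact hφ.comp (by fun_prop) (fun t ht => ⟨by linarith [ht.1], by linarith [ht.2]⟩)
  · intro t ht
    rw [hu] at ht
    rcases ht with ht | ht
    · rw [hl t ht]; exact hr t ht
    · rw [hri t ht]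
      have hτ : t - n ∈ Icc (0:ℝ) 1 := ⟨by linarith [ht.1], by linarith [ht.2]⟩
      obtain ⟨r, hr0, e⟩ := hr n ⟨hn, le_rfl⟩
      obtain ⟨r', hr0', e'⟩ := hφr _ hτ
      refine ⟨r * r', by positivity, ?_⟩
      have h2 := S.D_nat_add n hτ p vv
      rw [add_sub_cancel, ← D_nat, e, map_smul, e', smul_smul] at h2
      exact h2
  · rw [hri _ (by push_cast; constructor <;> linarith)]
    push_cast
    rw [add_sub_cancel_left, h1]

lemma rep_overconj {p : Pl} {n : ℕ} {Θ : ℝ → ℝ} (h : S.Rep p (n + 1) Θ) (h0 : Θ 0 = 0)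
    (h1 : Θ ((n + 1 : ℕ) : ℝ) < -1/2) : S.OverConjLift p :=
  ⟨n + 1, by omega, _, ⟨Θ, h.1, h.2, rfl⟩, by rw [h0, sub_zero]; exact h1⟩

lemma vert_rep (ht : S.PosTwist) {p : Pl} (hp : ¬ S.OverConjLift p) (n : ℕ) :
    ∃ Θ : ℝ → ℝ, S.Rep p (n + 1) Θ ∧ Θ 0 = 0 ∧ -1/2 < Θ ((n + 1 : ℕ) : ℝ) ∧
      Θ ((n + 1 : ℕ) : ℝ) < 0 := by
  induction n with
  | zero =>
    obtain ⟨b, hb, hb1, hb2⟩ := S.step_twist ht p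
    have h0 : S.Rep p 0 (fun _ => 0) := by
      refine ⟨continuousOn_const, fun t htt => ⟨1, one_pos, ?_⟩⟩
      have : t = ((0:ℕ):ℝ) := by
        have h1 := htt.1; have h2 := htt.2
        push_cast at h2 ⊢; linarith
      rw [this, D_nat, ee_zero]
      simp [vv]
    obtain ⟨Θ', h1, h2, h3⟩ := S.rep_extend h0 (b := b) hb
    exact ⟨Θ', h1, h2, by rw [h3]; exact hb1, by rw [h3]; exact hb2⟩
  | succ n ih =>
    obtain ⟨Θ, hR, h0, hl, hu⟩ := ih
    obtain ⟨b, hb⟩ := S.step_exists (S.F^[n+1] p) (Θ ((n + 1 : ℕ) : ℝ))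
    obtain ⟨Θ', h1, h2, h3⟩ := S.rep_extend hR hb
    obtain ⟨b0, hb0, hb1, hb2⟩ := S.step_twist ht (S.F^[n+1] p)
    have hlt := S.step_compare hb hb0 hu (by linarith)
    refine ⟨Θ', h1, by rw [h2, h0], ?_, by rw [h3]; linarith⟩
    by_contra hn
    push Not at hn
    rcases lt_or_eq_of_le hn with hn | hn
    · exact hp (S.rep_overconj h1 (by rw [h2, h0]) hn)
    · obtain ⟨c, hc, hc1, hc2⟩ := S.step_twist ht (S.F^[n+1+1] p)
      have hc' := S.step_half hc
      rw [show (0:ℝ) - 1/2 = -1/2 by norm_num, ← hn] at hc'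
      obtain ⟨Θ2, k1, k2, k3⟩ := S.rep_extend h1 hc'
      exact hp (S.rep_overconj k1 (by rw [k2, h2, h0]) (by rw [k3]; linarith))

lemma vert_pos (ht : S.PosTwist) {p : Pl} (hp : ¬ S.OverConjLift p) (n : ℕ) :
    0 < (fderiv ℝ (S.F^[n+1]) p (0, 1)).1 := by
  obtain ⟨Θ, hR, h0, hl, hu⟩ := S.vert_rep ht hp n
  obtain ⟨r, hr, e⟩ := hR.2 ((n + 1 : ℕ) : ℝ) ⟨by positivity, le_rfl⟩
  rw [D_nat] at e
  change fderiv ℝ (S.F^[n+1]) p (0, 1) = _ at e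
  rw [e, Prod.smul_fst, smul_eq_mul]
  exact mul_pos hr (ee_pos hl hu)

lemma dir_inv (ht : S.PosTwist) {p : Pl} (hp : ¬ S.OverConjLift p) {θ : ℝ} (h0 : 0 < θ)
    (h1 : θ < 1/2) (hF : 0 < (fderiv ℝ S.F p (ee θ)).1) (n : ℕ) :
    ∃ a α r ρ : ℝ, 0 < r ∧ 0 < ρ ∧ -1/2 < a ∧ a < α ∧ α < 0 ∧
      fderiv ℝ (S.F^[n+1]) p (0, 1) = r • ee a ∧ fderiv ℝ (S.F^[n+1]) p (ee θ) = ρ • ee α := by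
  induction n with
  | zero =>
    obtain ⟨a, ha, ha1, ha2⟩ := S.step_twist ht p
    obtain ⟨α, hα⟩ := S.step_exists p θ
    obtain ⟨c1, c2⟩ := S.step_compare ha hα h0 (by linarith)
    obtain ⟨r, hr, e⟩ := S.step_end ha
    obtain ⟨ρ, hρ, e'⟩ := S.step_end hα
    refine ⟨a, α, r, ρ, hr, hρ, ha1, c1, ?_, ?_, ?_⟩
    · by_contra hn
      push Not at hn
      rw [e', Prod.smul_fst, smul_eq_mul] at hF
      nlinarith [ee_nonpos hn (by linarith)]
    · rw [ee_zero] at e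
      simpa using e
    · simpa using e'
  | succ n ih =>
    obtain ⟨a, α, r, ρ, hr, hρ, i1, i2, i3, e1, e2⟩ := ih
    set q := S.F^[n+1] p
    obtain ⟨b0, hb0, hb1, hb2⟩ := S.step_twist ht q
    obtain ⟨b, hb⟩ := S.step_exists q a
    obtain ⟨β, hβ⟩ := S.step_exists q α
    obtain ⟨c1, c2⟩ := S.step_compare hb hβ i2 (by linarith)
    obtain ⟨c3, c4⟩ := S.step_compare hβ hb0 i3 (by linarith)
    obtain ⟨c5, c6⟩ := S.step_compare hb hb0 (by linarith) (by linarith)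
    obtain ⟨s, hs, f1⟩ := S.step_end hb
    obtain ⟨σ, hσ, f2⟩ := S.step_end hβ
    have g1 : fderiv ℝ (S.F^[n+1+1]) p (0, 1) = (r * s) • ee b := by
      rw [fderiv_succ, e1, map_smul, f1, smul_smul]
    have g2 : fderiv ℝ (S.F^[n+1+1]) p (ee θ) = (ρ * σ) • ee β := by
      rw [fderiv_succ, e2, map_smul, f2, smul_smul]
    refine ⟨b, β, r * s, ρ * σ, by positivity, by positivity, ?_, c1, by linarith, g1, g2⟩
    by_contra hn
    push Not at hn
    have hv := S.vert_pos ht hp (n+1)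
    rw [g1, Prod.smul_fst, smul_eq_mul] at hv
    have : 0 < r * s := by positivity
    nlinarith [ee_nonpos' (θ := b) (by linarith) hn]

lemma dir_pos (ht : S.PosTwist) {p : Pl} (hp : ¬ S.OverConjLift p) {θ : ℝ} (h0 : 0 ≤ θ)
    (h1 : θ < 1/2) (hF : 0 < (fderiv ℝ S.F p (ee θ)).1) (n : ℕ) :
    0 < (fderiv ℝ (S.F^[n+1]) p (ee θ)).1 := by
  rcases eq_or_lt_of_le h0 with h | h
  · rw [← h, ee_zero]; exact S.vert_pos ht hp n
  · obtain ⟨a, α, r, ρ, hr, hρ, i1, i2, i3, e1, e2⟩ := S.dir_inv ht hp h h1 hF n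
    rw [e2, Prod.smul_fst, smul_eq_mul]
    exact mul_pos hρ (ee_pos (by linarith) i3)

lemma fderiv_per_nat (p : Pl) (m : ℤ) : fderiv ℝ S.F (p + ((m:ℝ), 0)) = fderiv ℝ S.F p := by
  have h1 : ∀ p : Pl, fderiv ℝ S.F (p + (1, 0)) = fderiv ℝ S.F p := by
    intro p
    have h : (fun q => S.F (q + (1, 0))) = fun q => S.F q + (1, 0) := funext (S.Ft_periodic 1)
    have h2 := congrArg (fun g => fderiv ℝ g p) h
    simp only [fderiv_comp_add_right, fderiv_add_const] at h2
    exact h2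
  induction m using Int.induction_on with
  | zero =>
    congr 1
    ext <;> simp
  | succ k ih =>
    rw [← ih, ← h1 (p + (((k:ℤ):ℝ), 0))]
    congr 1
    ext <;> simp [add_assoc]
  | pred k ih =>
    rw [← ih, ← h1 (p + (((-(k:ℤ) - 1 : ℤ):ℝ), 0))]
    congr 1
    ext <;> simp [add_assoc]

lemma exists_beta (ht : S.PosTwist) (M : ℝ) : ∃ β : ℝ, 0 < β ∧ β < 1/2 ∧
    ∀ p : Pl, p.2 ∈ Icc (-M) M → ∀ θ ∈ Icc (0:ℝ) β, 0 < (fderiv ℝ S.F p (ee θ)).1 := by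
  have hB : IsCompact (Icc (0:ℝ) 1 ×ˢ Icc (-M) M) := isCompact_Icc.prod isCompact_Icc
  have hcont : Continuous (fun x : ℝ × Pl => (fderiv ℝ S.F x.2 (ee x.1)).1) := by
    have h1 := (S.F_smooth.continuous_fderiv one_ne_zero)
    have h2 := ee_continuous
    have h3 : Continuous (fun x : ℝ × Pl => fderiv ℝ S.F x.2 (ee x.1)) :=
      (h1.comp continuous_snd).clm_apply (h2.comp continuous_fst)
    exact h3.fst
  have hev : ∀ᶠ θ in 𝓝 (0:ℝ), ∀ p ∈ Icc (0:ℝ) 1 ×ˢ Icc (-M) M,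
      0 < (fderiv ℝ S.F p (ee θ)).1 := by
    apply hB.eventually_forall_of_forall_eventually
    intro p _
    have : 0 < (fun x : ℝ × Pl => (fderiv ℝ S.F x.2 (ee x.1)).1) (0, p) := by
      simp only [ee_zero]; exact S.twist_deriv ht p
    exact hcont.continuousAt.eventually (lt_mem_nhds this)
  obtain ⟨ε, hε, h⟩ := Metric.eventually_nhds_iff.1 hev
  refine ⟨min (ε/2) (1/4), by positivity, by
    have := min_le_right (ε/2) (1/4); linarith, fun p hp θ hθ => ?_⟩
  have h1 := S.fderiv_per_nat (p + ((-(⌊p.1⌋:ℝ)), 0)) ⌊p.1⌋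
  have h2 : (p + ((-(⌊p.1⌋:ℝ)), 0) + ((⌊p.1⌋:ℝ), 0) : Pl) = p := by ext <;> simp
  rw [h2] at h1
  rw [h1]
  refine h (y := θ) ?_ _ ?_
  · rw [Real.dist_eq, sub_zero, abs_of_nonneg hθ.1]
    linarith [hθ.2, min_le_left (ε/2) (1/4)]
  · refine ⟨⟨?_, ?_⟩, by simpa using hp⟩
    · simp only [Prod.fst_add]; linarith [Int.floor_le p.1]
    · simp only [Prod.fst_add]; linarith [(Int.lt_floor_add_one p.1).le]

end IsotopySetup

/-- Let `f` be a positive twist map with lift `F` and `K ⊆ 𝔸` a compact set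
containing no point with over-conjugate points. Then there is `β ∈ (0,1/2)` such that for all
`z, z' ∈ π⁻¹(K)` with the oriented angle `≺(v, z'−z)` in `[0,β] + ℤ` and the segment from `z`
to `z'` contained in `π⁻¹(K)`, one has `p₁(Fⁿ(z')) − p₁(Fⁿ(z)) > 0` for all `n ≥ 1`. -/
theorem statement7 (S : IsotopySetup) (htwist : S.PosTwist)
    (K : Set Ann) (hK : IsCompact K) (hnoover : ∀ z ∈ K, ¬ S.OverConj z) :
    ∃ β : ℝ, 0 < β ∧ β < 1/2 ∧
      ∀ z z' : Pl, z ∈ pr ⁻¹' K → z' ∈ pr ⁻¹' K → z ≠ z' →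
        (∃ θ ∈ Icc (0:ℝ) β, ∃ r : ℝ, 0 < r ∧
          z' - z = r • (-Real.sin (2 * Real.pi * θ), Real.cos (2 * Real.pi * θ))) →
        segment ℝ z z' ⊆ pr ⁻¹' K →
        ∀ n : ℕ, 1 ≤ n → 0 < (S.F^[n] z').1 - (S.F^[n] z).1 := by
  obtain ⟨M, hM⟩ : ∃ M : ℝ, ∀ x ∈ K, ‖x.2‖ ≤ M := by
    obtain ⟨M, hM⟩ := hK.exists_bound_of_continuousOn (f := fun x : Ann => x.2)
      continuous_snd.continuousOn
    exact ⟨M, hM⟩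
  obtain ⟨β, hβ0, hβ1, hβ⟩ := S.exists_beta htwist M
  refine ⟨β, hβ0, hβ1, ?_⟩
  rintro z z' - - - ⟨θ, hθ, r, hr, hz⟩ hseg n hn
  obtain ⟨n, rfl⟩ : ∃ m, n = m + 1 := ⟨n - 1, by omega⟩
  change z' - z = r • ee θ at hz
  have hpos : ∀ p : Pl, pr p ∈ K → 0 < (fderiv ℝ (S.F^[n+1]) p (z' - z)).1 := by
    intro p hp
    have hb : p.2 ∈ Icc (-M) M := abs_le.1 (hM _ hp)
    have := S.dir_pos htwist (fun h => hnoover _ hp ⟨p, rfl, h⟩) hθ.1 (by linarith [hθ.2])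
      (hβ p hb θ hθ) n
    rw [hz, map_smul, Prod.smul_fst, smul_eq_mul]
    exact mul_pos hr this
  have hd : ∀ s : ℝ, HasDerivAt (fun s : ℝ => (S.F^[n+1] (z + s • (z' - z))).1)
      (fderiv ℝ (S.F^[n+1]) (z + s • (z' - z)) (z' - z)).1 s := by
    intro s
    have h1 : HasDerivAt (fun s : ℝ => z + s • (z' - z)) (z' - z) s := by
      simpa using ((hasDerivAt_id s).smul_const (z' - z)).const_add z
    have h2 := (S.Fn_diff (n+1) (z + s • (z' - z))).hasFDerivAt.comp_hasDerivAt s h1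
    exact (ContinuousLinearMap.fst ℝ ℝ ℝ).hasFDerivAt.comp_hasDerivAt s h2
  have hmono : StrictMonoOn (fun s : ℝ => (S.F^[n+1] (z + s • (z' - z))).1) (Icc 0 1) := by
    apply strictMonoOn_of_deriv_pos (convex_Icc 0 1)
    · exact fun s _ => (hd s).continuousAt.continuousWithinAt
    · intro s hs
      rw [interior_Icc] at hs
      rw [(hd s).deriv]
      apply hpos
      apply hseg
      rw [segment_eq_image']
      exact ⟨s, ⟨hs.1.le, hs.2.le⟩, rfl⟩
  have := hmono (by simp) (by simp) (zero_lt_one (α := ℝ))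
  simp only [zero_smul, add_zero, one_smul, add_sub_cancel] at this
  linarith

end
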